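/- arXiv:2503.01913 — 3 statements merged into one kernel-verified Lean document; each statement's English description precedes it below -/
import Mathlib

section
/- Let n ≥ 1 and let (d, r) be an arithmetical structure on the fan graph F_n such that r_0 divides r_{2m−1} + r_{2m} for some m with 1 ≤ m ≤ n. Define vectors d̃ and r̃ of length 2n+3 by: d̃_0 = d_0 + (r_{2m−1} + r_{2m})/r_0, d̃_i = d_i for 1 ≤ i ≤ 2n, d̃_{2n+1} = d_{2m−1}, d̃_{2n+2} = d_{2m}; and r̃_i = r_i for 0 ≤ i ≤ 2n, r̃_{2n+1} = r_{2m−1}, r̃_{2n+2} = r_{2m}. Then (d̃, r̃) is an arithmetical structure on the fan graph F_{n+1}. -/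
/-- Adjacency matrix of the fan graph `F_n` on vertices `{0, 1, …, 2n}`. -/
def fanAdj (n : ℕ) : Matrix (Fin (2*n+1)) (Fin (2*n+1)) ℤ :=
  Matrix.of fun i j =>
    if (i.val = 0 ∧ j.val ≠ 0) ∨ (j.val = 0 ∧ i.val ≠ 0)
       ∨ (i.val % 2 = 1 ∧ j.val = i.val + 1)
       ∨ (j.val % 2 = 1 ∧ i.val = j.val + 1) then 1 else 0

/-- An arithmetical structure on a graph with adjacency matrix `A`. -/
def IsArithStructure {N : ℕ} (A : Matrix (Fin N) (Fin N) ℤ) (d r : Fin N → ℤ) : Prop :=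
  (∀ i, 0 < d i) ∧ (∀ i, 0 < r i) ∧ Finset.univ.gcd r = 1 ∧
    (Matrix.diagonal d - A).mulVec r = 0

open Matrix in
theorem diagonal_sub_mulVec_eq_zero_iff {N : ℕ} (A : Matrix (Fin N) (Fin N) ℤ)
    (d r : Fin N → ℤ) :
    (Matrix.diagonal d - A).mulVec r = 0 ↔ ∀ i, d i * r i = (A *ᵥ r) i := by
  simp [funext_iff, Matrix.sub_mulVec, Matrix.mulVec_diagonal, sub_eq_zero]

open Matrix in
/-- The hub of the fan is adjacent to every other vertex. -/
theorem fanAdj_mulVec_zero (n : ℕ) (r : Fin (2*n+1) → ℤ) :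
    (fanAdj n *ᵥ r) 0 = ∑ j, r j - r 0 := by
  rw [Matrix.mulVec, dotProduct, ← Finset.sum_erase_eq_sub (Finset.mem_univ (0 : Fin (2*n+1))), ← Finset.filter_ne',
    Finset.sum_filter]
  refine Finset.sum_congr rfl fun j _ => ?_
  by_cases hj : j = 0 <;> simp [fanAdj, hj]

open Matrix in
/-- A rim vertex `i` of the fan is adjacent exactly to the hub and to its partner `p`. -/
theorem fanAdj_mulVec_of_partner (n : ℕ) (r : Fin (2*n+1) → ℤ) (i p : Fin (2*n+1))
    (hip : i.val % 2 = 1 ∧ p.val = i.val + 1 ∨ p.val % 2 = 1 ∧ i.val = p.val + 1) :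
    (fanAdj n *ᵥ r) i = r 0 + r p := by
  have hp : (0 : Fin (2*n+1)) ≠ p := by
    rw [Ne, Fin.ext_iff, Fin.val_zero]
    omega
  rw [Matrix.mulVec, dotProduct, ← Finset.sum_pair hp, ← Finset.univ_inter {0, p}, ← Finset.filter_mem_eq_inter,
    Finset.sum_filter]
  refine Finset.sum_congr rfl fun j _ => ?_
  have hadj : ((i.val = 0 ∧ j.val ≠ 0) ∨ (j.val = 0 ∧ i.val ≠ 0)
       ∨ (i.val % 2 = 1 ∧ j.val = i.val + 1)
       ∨ (j.val % 2 = 1 ∧ i.val = j.val + 1)) ↔ j ∈ ({0, p} : Finset _) := by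
    rw [Finset.mem_insert, Finset.mem_singleton, Fin.ext_iff, Fin.ext_iff, Fin.val_zero]
    omega
  simp only [fanAdj, Matrix.of_apply, hadj, ite_mul, one_mul, zero_mul]

theorem sum_univ_fan_succ {M : Type*} [AddCommMonoid M] (n : ℕ) (f : Fin (2*(n+1)+1) → M) :
    ∑ j, f j = ∑ j : Fin (2*n+1), f ⟨j.val, by omega⟩ +
      (f ⟨2*n+1, by omega⟩ + f ⟨2*n+2, by omega⟩) := by
  refine (Fin.sum_univ_castSucc (n := 2*n+2) f).trans ?_
  rw [Fin.sum_univ_castSucc, add_assoc]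
  rfl

theorem exists_partner (n : ℕ) (i : Fin (2*n+1)) (hi : i.val ≠ 0) :
    ∃ p : Fin (2*n+1),
      i.val % 2 = 1 ∧ p.val = i.val + 1 ∨ p.val % 2 = 1 ∧ i.val = p.val + 1 := by
  obtain h | h := Nat.mod_two_eq_zero_or_one i.val
  · exact ⟨⟨i.val - 1, by omega⟩, by dsimp only; omega⟩
  · exact ⟨⟨i.val + 1, by omega⟩, by dsimp only; omega⟩

theorem Int.finset_gcd_eq_one_of_dvd {ι κ : Type*} {s : Finset ι} {t : Finset κ} {f : ι → ℤ}
    {g : κ → ℤ} (hf : s.gcd f = 1) (h : ∀ i ∈ s, t.gcd g ∣ f i) : t.gcd g = 1 :=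
  Int.eq_one_of_dvd_one (Int.nonneg_of_normalize_eq_self Finset.normalize_gcd)
    (hf ▸ Finset.dvd_gcd h)

/-- Duplicating the `m`-th arm of an arithmetical structure on `F_n` (when
`r_0 ∣ r_{2m-1} + r_{2m}`) gives an arithmetical structure on `F_{n+1}`. -/
theorem stmt_7 (n m : ℕ) (hn : 1 ≤ n) (hm1 : 1 ≤ m) (hm2 : m ≤ n)
    (d r : Fin (2*n+1) → ℤ) (h : IsArithStructure (fanAdj n) d r)
    (hdiv : r 0 ∣ r ⟨2*m - 1, by omega⟩ + r ⟨2*m, by omega⟩) :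
    IsArithStructure (fanAdj (n+1))
      (fun j => if j.val = 0 then
          d 0 + (r ⟨2*m - 1, by omega⟩ + r ⟨2*m, by omega⟩) / r 0
        else if hj : j.val ≤ 2*n then d ⟨j.val, by omega⟩
        else if j.val = 2*n + 1 then d ⟨2*m - 1, by omega⟩
        else d ⟨2*m, by omega⟩)
      (fun j => if hj : j.val ≤ 2*n then r ⟨j.val, by omega⟩
        else if j.val = 2*n + 1 then r ⟨2*m - 1, by omega⟩
        else r ⟨2*m, by omega⟩) := by
  obtain ⟨hd, hr, hgcd, heq⟩ := h
  rw [diagonal_sub_mulVec_eq_zero_iff] at heq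
  have hrim : ∀ i p : Fin (2*n+1),
      (i.val % 2 = 1 ∧ p.val = i.val + 1 ∨ p.val % 2 = 1 ∧ i.val = p.val + 1) →
      d i * r i = r 0 + r p := fun i p hip =>
    (heq i).trans (fanAdj_mulVec_of_partner n r i p hip)
  refine ⟨fun j => ?_, fun j => ?_, ?_, ?_⟩
  · have hq : 0 ≤ (r ⟨2*m - 1, by omega⟩ + r ⟨2*m, by omega⟩) / r 0 :=
      Int.ediv_nonneg (add_pos (hr _) (hr _)).le (hr 0).le
    dsimp only
    split_ifs
    · exact add_pos_of_pos_of_nonneg (hd 0) hq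
    all_goals exact hd _
  · dsimp only
    split_ifs <;> exact hr _
  · refine Int.finset_gcd_eq_one_of_dvd hgcd fun i _ => ?_
    refine (Finset.gcd_dvd (Finset.mem_univ (⟨i.val, by omega⟩ : Fin (2*(n+1)+1)))).trans ?_
    rw [dif_pos (show i.val ≤ 2*n by omega)]
  · rw [diagonal_sub_mulVec_eq_zero_iff]
    intro i
    by_cases hi : i.val = 0
    · obtain rfl : i = 0 := Fin.ext hi
      have h0 := heq 0
      rw [fanAdj_mulVec_zero] at h0 ⊢
      rw [sum_univ_fan_succ]
      have hle : ∀ x : Fin (2*n+1), x.val ≤ 2*n := fun x => by omega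
      simp [hle, add_mul, Int.ediv_mul_cancel hdiv, h0]
      ring
    · obtain ⟨p, hp⟩ := exists_partner (n+1) i hi
      rw [fanAdj_mulVec_of_partner (n+1) _ i p hp]
      simp only [hi, if_false]
      by_cases hi' : i.val ≤ 2*n
      · have hp' : p.val ≤ 2*n := by omega
        simpa [hi', hp'] using hrim ⟨i.val, by omega⟩ ⟨p.val, by omega⟩ hp
      · have hp' : ¬ p.val ≤ 2*n := by omega
        obtain ⟨h1, h2⟩ | ⟨h1, h2⟩ : i.val = 2*n+1 ∧ p.val = 2*n+2 ∨
            i.val = 2*n+2 ∧ p.val = 2*n+1 := by omega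
        · simpa [h1, h2] using hrim ⟨2*m-1, by omega⟩ ⟨2*m, by omega⟩
            (by dsimp only; omega)
        · simpa [h1, h2] using hrim ⟨2*m, by omega⟩ ⟨2*m-1, by omega⟩
            (by dsimp only; omega)
end

section
/- Let n ≥ 1, let r_0 be a positive integer, and for each i with 1 ≤ i ≤ n let (r_0, a_i, b_i) be an arithmetical r-structure on the cycle C_3, i.e., a_i, b_i are positive integers with gcd(r_0, a_i, b_i) = 1, a_i divides r_0 + b_i, b_i divides r_0 + a_i, and r_0 divides a_i + b_i. Then the vector r̃ = (r_0, a_1, b_1, a_2, b_2, …, a_n, b_n) together with the vector d̃ given by d̃_0 = (Σ_{i=1}^n (a_i + b_i))/r_0, d̃_{2i−1} = (r_0 + b_i)/a_i and d̃_{2i} = (r_0 + a_i)/b_i for 1 ≤ i ≤ n, forms an arithmetical structure (d̃, r̃) on the fan graph F_n. -/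
/-- A sum over the vertices of `F_n` splits into the hub and the `n` arms. -/
theorem sum_fan_vertices {M : Type*} [AddCommMonoid M] {n : ℕ} (f : Fin (2 * n + 1) → M) :
    ∑ j, f j = f 0 + ∑ i : Fin n, (f ⟨2 * i + 1, by omega⟩ + f ⟨2 * i + 2, by omega⟩) := by
  induction n with
  | zero => simp
  | succ n ih =>
    rw [Fin.sum_univ_castSucc (n := n), ← add_assoc]
    have h : ∑ j, f j = ∑ j : Fin (2 * n + 1), f j.castSucc.castSucc +
        f (Fin.last (2 * n + 1)).castSucc + f (Fin.last (2 * n + 2)) := by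
      rw [← Fin.sum_univ_castSucc fun j : Fin (2 * n + 2) => f j.castSucc]
      exact Fin.sum_univ_castSucc (n := 2 * n + 2) f
    rw [h, ih fun j => f j.castSucc.castSucc, add_assoc]
    rfl

/-- Every vertex of `F_n` is the hub or one of the two vertices of an arm. -/
theorem forall_fan_vertices {n : ℕ} {P : Fin (2 * n + 1) → Prop} (hub : P 0)
    (odd : ∀ k : Fin n, P ⟨2 * k + 1, by omega⟩) (even : ∀ k : Fin n, P ⟨2 * k + 2, by omega⟩)
    (j : Fin (2 * n + 1)) : P j := by
  obtain ⟨j, hj⟩ := j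
  obtain rfl | ⟨k, hk, rfl | rfl⟩ : j = 0 ∨ ∃ k < n, j = 2 * k + 1 ∨ j = 2 * k + 2 := by
    by_cases h : j = 0
    · exact Or.inl h
    · exact Or.inr ⟨(j - 1) / 2, by omega, by omega⟩
  · exact hub
  · exact odd ⟨k, hk⟩
  · exact even ⟨k, hk⟩

theorem fanAdj_mulVec_hub {n : ℕ} (r : Fin (2 * n + 1) → ℤ) :
    (fanAdj n).mulVec r 0 =
      ∑ i : Fin n, (r ⟨2 * i + 1, by omega⟩ + r ⟨2 * i + 2, by omega⟩) := by
  rw [Matrix.mulVec, dotProduct, sum_fan_vertices]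
  simp [fanAdj]

theorem fanAdj_mulVec_odd {n : ℕ} (r : Fin (2 * n + 1) → ℤ) (k : Fin n) :
    (fanAdj n).mulVec r ⟨2 * k + 1, by omega⟩ = r 0 + r ⟨2 * k + 2, by omega⟩ := by
  rw [Matrix.mulVec, dotProduct, sum_fan_vertices, Finset.sum_eq_single k]
  · simp [fanAdj]
  · intro i _ hik
    have hik : (i : ℕ) ≠ k := Fin.val_ne_of_ne hik
    simp only [fanAdj, Matrix.of_apply]
    rw [if_neg (by omega), if_neg (by omega)]
    simp
  · simp

theorem fanAdj_mulVec_even {n : ℕ} (r : Fin (2 * n + 1) → ℤ) (k : Fin n) :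
    (fanAdj n).mulVec r ⟨2 * k + 2, by omega⟩ = r 0 + r ⟨2 * k + 1, by omega⟩ := by
  rw [Matrix.mulVec, dotProduct, sum_fan_vertices, Finset.sum_eq_single k]
  · simp [fanAdj]
  · intro i _ hik
    have hik : (i : ℕ) ≠ k := Fin.val_ne_of_ne hik
    simp only [fanAdj, Matrix.of_apply]
    rw [if_neg (by omega), if_neg (by omega)]
    simp
  · simp

/-- Gluing `n` arithmetical r-structures `(r_0, a_i, b_i)` on `C_3` along the
common value `r_0` yields an arithmetical structure on the fan graph `F_n`.
Here arm `i` (for `i : Fin n`) consists of the vertices `2i+1` and `2i+2`. -/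
theorem stmt_8 (n : ℕ) (hn : 1 ≤ n) (r0 : ℤ) (hr0 : 0 < r0)
    (a b : Fin n → ℤ) (ha : ∀ i, 0 < a i) (hb : ∀ i, 0 < b i)
    (hgcd : ∀ i, gcd r0 (gcd (a i) (b i)) = 1)
    (hab : ∀ i, a i ∣ r0 + b i) (hba : ∀ i, b i ∣ r0 + a i)
    (h0 : ∀ i, r0 ∣ a i + b i) :
    IsArithStructure (fanAdj n)
      (fun j => if hj0 : j.val = 0 then (∑ i, (a i + b i)) / r0
        else if hj : j.val % 2 = 1 then
          (r0 + b ⟨(j.val - 1)/2, by have := j.isLt; omega⟩) /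
            a ⟨(j.val - 1)/2, by have := j.isLt; omega⟩
        else
          (r0 + a ⟨j.val/2 - 1, by have := j.isLt; omega⟩) /
            b ⟨j.val/2 - 1, by have := j.isLt; omega⟩)
      (fun j => if hj0 : j.val = 0 then r0
        else if hj : j.val % 2 = 1 then a ⟨(j.val - 1)/2, by have := j.isLt; omega⟩
        else b ⟨j.val/2 - 1, by have := j.isLt; omega⟩) := by
  have hodd (k : ℕ) : (2 * k + 1) % 2 = 1 := by omega
  have hsum : 0 < ∑ i, (a i + b i) :=
    Finset.sum_pos (fun i _ => add_pos (ha i) (hb i)) ⟨⟨0, hn⟩, Finset.mem_univ _⟩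
  have hdvd : r0 ∣ ∑ i, (a i + b i) := Finset.dvd_sum fun i _ => h0 i
  refine ⟨forall_fan_vertices ?_ (fun k => ?_) fun k => ?_,
    forall_fan_vertices ?_ (fun k => ?_) fun k => ?_, ?_,
    funext <| forall_fan_vertices ?_ (fun k => ?_) fun k => ?_⟩
  · simpa using Int.ediv_pos_of_pos_of_dvd hsum hr0.le hdvd
  · simpa [hodd] using
      Int.ediv_pos_of_pos_of_dvd (add_pos hr0 (hb k)) (ha k).le (hab k)
  · simpa using
      Int.ediv_pos_of_pos_of_dvd (add_pos hr0 (ha k)) (hb k).le (hba k)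
  · simpa using hr0
  · simpa [hodd] using ha k
  · simpa using hb k
  · rw [← Finset.normalize_gcd, normalize_eq_one, isUnit_iff_dvd_one, ← hgcd ⟨0, hn⟩]
    refine dvd_gcd ?_ (dvd_gcd ?_ ?_)
    · exact Finset.gcd_dvd (Finset.mem_univ (0 : Fin (2 * n + 1)))
    · refine (Finset.gcd_dvd (Finset.mem_univ (⟨1, by omega⟩ : Fin (2 * n + 1)))).trans ?_
      simp
    · refine (Finset.gcd_dvd (Finset.mem_univ (⟨2, by omega⟩ : Fin (2 * n + 1)))).trans ?_
      simp
  · rw [Matrix.sub_mulVec, Pi.sub_apply, Matrix.mulVec_diagonal, fanAdj_mulVec_hub]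
    simp [hodd, Int.ediv_mul_cancel hdvd]
  · rw [Matrix.sub_mulVec, Pi.sub_apply, Matrix.mulVec_diagonal, fanAdj_mulVec_odd]
    simp [hodd, Int.ediv_mul_cancel (hab k)]
  · rw [Matrix.sub_mulVec, Pi.sub_apply, Matrix.mulVec_diagonal, fanAdj_mulVec_even]
    simp [hodd, Int.ediv_mul_cancel (hba k)]
end

section
/- Let m ≥ 1, let (d, r) be an arithmetical structure on the star graph S_m, and let (d̃, r̃) be the arithmetical structure on S_{m+1} given by d̃_0 = d_0 + 1, d̃_i = d_i for 1 ≤ i ≤ m, d̃_{m+1} = 1, r̃_i = r_i for 0 ≤ i ≤ m, r̃_{m+1} = r_0. Then there exist (m+2)×(m+2) integer matrices P and Q, each invertible over the integers (i.e., with determinant ±1), such that P·(diag(d̃) − A(S_{m+1}))·Q equals the block-diagonal matrix whose upper-left (m+1)×(m+1) block is diag(d) − A(S_m), whose lower-right 1×1 block is 1, and whose off-diagonal blocks are 0. Consequently the torsion subgroups of the cokernels ℤ^{m+1}/Im(diag(d) − A(S_m)) and ℤ^{m+2}/Im(diag(d̃) − A(S_{m+1})) are isomorphic, i.e., the critical groups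 satisfy Φ(S_m, d, r) ≅ Φ(S_{m+1}, d̃, r̃). -/
/-- Adjacency matrix of the star graph `S_n` on vertices `{0, 1, …, n}` with
center `0`. -/
def starAdj (n : ℕ) : Matrix (Fin (n+1)) (Fin (n+1)) ℤ :=
  Matrix.of fun i j =>
    if (i.val = 0 ∧ j.val ≠ 0) ∨ (j.val = 0 ∧ i.val ≠ 0) then 1 else 0

/-- The critical group of an integer matrix `L` (viewed as the Laplacian-type
matrix of an arithmetical structure): the torsion submodule of its cokernel. -/
def criticalGroup {N : ℕ} (L : Matrix (Fin N) (Fin N) ℤ) :=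
  Submodule.torsion ℤ ((Fin N → ℤ) ⧸ LinearMap.range (Matrix.mulVecLin L))

open Matrix in
/-- Clearing the off-diagonal blocks of a block matrix with lower-right block `1`
by unimodular row and column operations. -/
theorem exists_unimodular_mul_mul_eq_of_fromBlocks {n o k : Type*} [Fintype n] [Fintype o]
    [Fintype k] [DecidableEq n] [DecidableEq o] [DecidableEq k] (e : n ⊕ o ≃ k)
    {L : Matrix n n ℤ} {B : Matrix n o ℤ} {C : Matrix o n ℤ} {M N : Matrix k k ℤ}
    (hM : M.submatrix e e = fromBlocks (L + B * C) B C 1)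
    (hN : N.submatrix e e = fromBlocks L 0 0 1) :
    ∃ P Q : Matrix k k ℤ, IsUnit P.det ∧ IsUnit Q.det ∧ P * M * Q = N := by
  refine ⟨(fromBlocks 1 (-B) 0 1).submatrix e.symm e.symm,
    (fromBlocks 1 0 (-C) 1).submatrix e.symm e.symm, by simp, by simp, ?_⟩
  have hM' : M = (fromBlocks (L + B * C) B C 1).submatrix e.symm e.symm := by
    simp [← hM, submatrix_submatrix]
  have hN' : N = (fromBlocks L 0 0 1).submatrix e.symm e.symm := by
    simp [← hN, submatrix_submatrix]
  rw [hM', hN', submatrix_mul_equiv, submatrix_mul_equiv]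
  simp [fromBlocks_multiply]

/-- A linear equivalence restricts to an equivalence of torsion submodules. -/
theorem nonempty_torsion_equiv {M N : Type*} [AddCommGroup M] [AddCommGroup N]
    (f : M ≃ₗ[ℤ] N) :
    Nonempty (Submodule.torsion ℤ M ≃ₗ[ℤ] Submodule.torsion ℤ N) := by
  refine ⟨f.ofSubmodules _ _ ?_⟩
  ext y
  rw [Submodule.mem_map_equiv, Submodule.mem_torsion_iff, Submodule.mem_torsion_iff]
  refine exists_congr fun a => ?_
  rw [Submonoid.smul_def, Submonoid.smul_def, ← map_smul, map_eq_zero_iff _ f.symm.injective]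

open Matrix in
/-- Eliminating a lower-right block `1` does not change the cokernel. -/
theorem nonempty_quotient_range_mulVecLin_equiv {n o k : Type*} [Fintype n] [Fintype o]
    [Fintype k] [DecidableEq n] [DecidableEq o] (e : n ⊕ o ≃ k)
    {L : Matrix n n ℤ} {B : Matrix n o ℤ} {C : Matrix o n ℤ} {M : Matrix k k ℤ}
    (hM : M.submatrix e e = fromBlocks (L + B * C) B C 1) :
    Nonempty (((k → ℤ) ⧸ LinearMap.range M.mulVecLin) ≃ₗ[ℤ]
      ((n → ℤ) ⧸ LinearMap.range L.mulVecLin)) := by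
  let φ : (k → ℤ) →ₗ[ℤ] (n → ℤ) :=
    LinearMap.funLeft ℤ ℤ (e ∘ Sum.inl) - B.mulVecLin ∘ₗ LinearMap.funLeft ℤ ℤ (e ∘ Sum.inr)
  have hφ (x : k → ℤ) : φ x = x ∘ e ∘ Sum.inl - B *ᵥ (x ∘ e ∘ Sum.inr) := rfl
  have hmul (u : k → ℤ) : (M *ᵥ u) ∘ e =
      Sum.elim ((L + B * C) *ᵥ (u ∘ e ∘ Sum.inl) + B *ᵥ (u ∘ e ∘ Sum.inr))
        (C *ᵥ (u ∘ e ∘ Sum.inl) + u ∘ e ∘ Sum.inr) := by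
    have := submatrix_mulVec_equiv M (u ∘ e) e e
    rw [hM, fromBlocks_mulVec] at this
    simpa [Function.comp_assoc] using this.symm
  have hφM (u : k → ℤ) : φ (M *ᵥ u) = L *ᵥ (u ∘ e ∘ Sum.inl) := by
    rw [hφ, ← Function.comp_assoc, ← Function.comp_assoc, hmul, Sum.elim_comp_inl,
      Sum.elim_comp_inr, add_mulVec, mulVec_add, mulVec_mulVec]
    abel
  have hsurj : Function.Surjective φ := fun y => by
    refine ⟨Sum.elim y 0 ∘ e.symm, ?_⟩
    have hinl : (Sum.elim y 0 ∘ e.symm) ∘ e ∘ Sum.inl = y := by ext; simp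
    have hinr : (Sum.elim y 0 ∘ e.symm) ∘ e ∘ Sum.inr = (0 : o → ℤ) := by ext; simp
    rw [hφ, hinl, hinr, mulVec_zero, sub_zero]
  have hker : LinearMap.ker ((LinearMap.range L.mulVecLin).mkQ ∘ₗ φ) =
      LinearMap.range M.mulVecLin := by
    ext x
    rw [LinearMap.ker_comp, Submodule.ker_mkQ, Submodule.mem_comap]
    constructor
    · rintro ⟨u, hu⟩
      refine ⟨Sum.elim u (x ∘ e ∘ Sum.inr - C *ᵥ u) ∘ e.symm, ?_⟩
      apply e.surjective.injective_comp_right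
      have hinl : (Sum.elim u (x ∘ e ∘ Sum.inr - C *ᵥ u) ∘ e.symm) ∘ e ∘ Sum.inl = u := by
        ext; simp
      have hinr : (Sum.elim u (x ∘ e ∘ Sum.inr - C *ᵥ u) ∘ e.symm) ∘ e ∘ Sum.inr =
          x ∘ e ∘ Sum.inr - C *ᵥ u := by
        ext; simp
      rw [mulVecLin_apply, hφ] at hu
      change (M *ᵥ _) ∘ e = x ∘ e
      rw [hmul, hinl, hinr, add_mulVec, hu, mulVec_sub, mulVec_mulVec]
      ext (i | i) <;> simp
    · rintro ⟨u, rfl⟩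
      exact ⟨_, (hφM u).symm⟩
  exact ⟨(Submodule.quotEquivOfEq _ _ hker.symm).trans
    (LinearMap.quotKerEquivOfSurjective _ ((Submodule.mkQ_surjective _).comp hsurj))⟩

open Matrix in
/-- The block decomposition of the leaf-extended star matrix. -/
theorem submatrix_diagonal_sub_starAdj_succ {m : ℕ} {d : Fin (m+1) → ℤ}
    {d' : Fin (m+1+1) → ℤ} (hd : ∀ i, d' (Fin.castAdd 1 i) = d i + if i = 0 then 1 else 0)
    (hlast : ∀ i, d' (Fin.natAdd (m+1) i) = 1) :
    (Matrix.diagonal d' - starAdj (m+1)).submatrix finSumFinEquiv finSumFinEquiv =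
      fromBlocks
        (Matrix.diagonal d - starAdj m +
          replicateCol (Fin 1) (-Pi.single 0 1 : Fin (m+1) → ℤ) *
            replicateRow (Fin 1) (-Pi.single 0 1 : Fin (m+1) → ℤ))
        (replicateCol (Fin 1) (-Pi.single 0 1)) (replicateRow (Fin 1) (-Pi.single 0 1)) 1 := by
  ext (i | i) (j | j) <;>
    simp [hd, hlast, starAdj, Matrix.diagonal_apply, Matrix.mul_apply, Matrix.one_apply,
      Pi.single_apply, Fin.ext_iff, -Fin.val_eq_zero_iff] <;>
    grind

/-- The leaf-extended structure on `S_{m+1}` has matrix `diag(d̃) − A(S_{m+1})`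
integrally equivalent to the block-diagonal matrix with blocks
`diag(d) − A(S_m)` and `1`; consequently the critical groups of
`(S_m, d, r)` and `(S_{m+1}, d̃, r̃)` are isomorphic. -/
theorem stmt_16 (m : ℕ) (hm : 1 ≤ m) (d r : Fin (m+1) → ℤ)
    (h : IsArithStructure (starAdj m) d r) :
    (∃ P Q : Matrix (Fin (m+1+1)) (Fin (m+1+1)) ℤ,
      IsUnit P.det ∧ IsUnit Q.det ∧
      P * (Matrix.diagonal
            (fun j : Fin (m+1+1) => if j.val = 0 then d 0 + 1
              else if hj : j.val ≤ m then d ⟨j.val, by omega⟩ else 1)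
          - starAdj (m+1)) * Q =
        Matrix.of (fun i j : Fin (m+1+1) =>
          if hi : i.val ≤ m then
            (if hj : j.val ≤ m then
              (Matrix.diagonal d - starAdj m) ⟨i.val, by omega⟩ ⟨j.val, by omega⟩
            else 0)
          else (if j.val ≤ m then 0 else 1))) ∧
    Nonempty
      ((criticalGroup (Matrix.diagonal d - starAdj m)) ≃ₗ[ℤ]
       (criticalGroup (Matrix.diagonal
          (fun j : Fin (m+1+1) => if j.val = 0 then d 0 + 1
            else if hj : j.val ≤ m then d ⟨j.val, by omega⟩ else 1)
          - starAdj (m+1)))) := by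
  have hM := submatrix_diagonal_sub_starAdj_succ (d := d)
    (d' := fun j => if j.val = 0 then d 0 + 1
      else if hj : j.val ≤ m then d ⟨j.val, by omega⟩ else 1)
    (fun i => by
      obtain rfl | hi := eq_or_ne i 0
      · simp
      · simp [hi, Fin.is_le])
    (fun i => by simp)
  refine ⟨exists_unimodular_mul_mul_eq_of_fromBlocks finSumFinEquiv hM ?_, ?_⟩
  · ext (i | i) (j | j) <;> simp [Fin.is_le, Matrix.one_apply, eq_iff_true_of_subsingleton]
  · obtain ⟨f⟩ := nonempty_quotient_range_mulVecLin_equiv finSumFinEquiv hM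
    exact nonempty_torsion_equiv f.symm
end
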